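/- Let U_P be a pattern group, u ∈ U_P and λ ∈ 𝔫_P*. Let S_1,…,S_k be the connected components of G_{u−1} and T_1,…,T_l the connected components of G_λ. Then χ^λ(u) = ∏_{j=1}^{l} ( χ^{λ[T_j]}(1) · ∏_{i=1}^{k} χ^{λ[T_j]}(u[S_i]) / χ^{λ[T_j]}(1) ). -/

import Mathlib

open Matrix BigOperators
open scoped Classical

/-- `n × n` matrices over `F`. -/
abbrev Mat (n : ℕ) (F : Type*) := Matrix (Fin n) (Fin n) F

section Defs

variable {n : ℕ} {F : Type*} [Field F] [Fintype F]

/-- The pattern group `U_P` attached to a relation `P` on `{0,…,n-1}`: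
unipotent upper-triangular matrices supported (off the diagonal) on positions `(i,j)` with `P i j`. -/
def patGroup (P : Fin n → Fin n → Prop) : Set (Mat n F) :=
  {u | (∀ i, u i i = 1) ∧ ∀ i j, i ≠ j → ¬ P i j → u i j = 0}

/-- Truncation of a matrix to the positions allowed by `P` (used to identify a functional on
`𝔫_P` with the matrix of its coefficients on allowable positions). -/
noncomputable def truncP (P : Fin n → Fin n → Prop) (A : Mat n F) : Mat n F :=
  Matrix.of fun i j => if P i j then A i j else 0

/-- The left orbit `U_P λ` of the functional (identified with a matrix) `lam`:
`(aλ)(x) = λ(a⁻¹ x)`, whose coefficient matrix is the truncation of `(a⁻¹)ᵀ * λ`. -/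
noncomputable def dualLeftOrbit (P : Fin n → Fin n → Prop) (lam : Mat n F) : Set (Mat n F) :=
  {mu | ∃ a ∈ (patGroup P : Set (Mat n F)), mu = truncP P ((a⁻¹)ᵀ * lam)}

/-- The two-sided orbit `U_P λ U_P` of the functional `lam`: `(aλb)(x) = λ(a⁻¹ x b⁻¹)`,
whose coefficient matrix is the truncation of `(a⁻¹)ᵀ * λ * (b⁻¹)ᵀ`. -/
noncomputable def dualOrbit (P : Fin n → Fin n → Prop) (lam : Mat n F) : Set (Mat n F) :=
  {mu | ∃ a ∈ (patGroup P : Set (Mat n F)), ∃ b ∈ (patGroup P : Set (Mat n F)),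
    mu = truncP P ((a⁻¹)ᵀ * lam * (b⁻¹)ᵀ)}

/-- The two-sided superclass orbit `{a (v-1) b : a, b ∈ U_P}` attached to `v ∈ U_P`. -/
def classOrbit (P : Fin n → Fin n → Prop) (v : Mat n F) : Set (Mat n F) :=
  {x | ∃ a ∈ (patGroup P : Set (Mat n F)), ∃ b ∈ (patGroup P : Set (Mat n F)),
    x = a * (v - 1) * b}

/-- The pairing `λ(x) = Σ_{i,j} λ_{ij} x_{ij}` of a functional-matrix with a matrix. -/
def pairM (A B : Mat n F) : F := ∑ i, ∑ j, A i j * B i j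

/-- The supercharacter `χ^λ` of the pattern group `U_P` attached to the functional `lam`:
`χ^λ(u) = (|U_Pλ|/|U_PλU_P|) Σ_{μ ∈ U_PλU_P} θ(−μ(u−1))`. -/
noncomputable def superChar (P : Fin n → Fin n → Prop) (θ : AddChar F ℂ)
    (lam u : Mat n F) : ℂ :=
  ((dualLeftOrbit P lam).ncard : ℂ) / ((dualOrbit P lam).ncard : ℂ) *
    ∑ᶠ mu ∈ dualOrbit P lam, θ (- pairM mu (u - 1))

/-- The full order `i < j`, whose pattern group is `U_n`. -/
def Plt (n : ℕ) : Fin n → Fin n → Prop := fun i j => i < j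

/-- The poset `𝒫_(m)` (in 0-based indexing): `i < j`, except that row `0` (row `1` in 1-based
indexing) is only comparable to columns `j` with 1-based value `j+1 > m`.  Its pattern group is
the interpolating group `U_(m)`. -/
def Pm (n m : ℕ) : Fin n → Fin n → Prop := fun i j => i < j ∧ (i.val = 0 → m < j.val + 1)

/-- `𝒮_n(q)`: strictly upper-triangular matrices with at most one nonzero entry in each row
and each column. -/
def Sset (n : ℕ) (F : Type*) [Field F] : Set (Mat n F) :=
  {lam | (∀ i j : Fin n, ¬ i < j → lam i j = 0) ∧
    (∀ (i j j' : Fin n), lam i j ≠ 0 → lam i j' ≠ 0 → j = j') ∧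
    (∀ (i i' j : Fin n), lam i j ≠ 0 → lam i' j ≠ 0 → i = i')}

/-- Adjacency of two nonzero positions of `A` (they share a row or a column): the edges of
the graph `G_A`. -/
def adjRel (A : Mat n F) (p q : Fin n × Fin n) : Prop :=
  p ≠ q ∧ A p.1 p.2 ≠ 0 ∧ A q.1 q.2 ≠ 0 ∧ (p.1 = q.1 ∨ p.2 = q.2)

/-- The connected component of the position `p` in the graph `G_A`. -/
def compOf (A : Mat n F) (p : Fin n × Fin n) : Set (Fin n × Fin n) :=
  {q | Relation.ReflTransGen (adjRel A) p q}

/-- The set of connected components of the graph `G_A`. -/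
def comps (A : Mat n F) : Set (Set (Fin n × Fin n)) :=
  {S | ∃ p : Fin n × Fin n, A p.1 p.2 ≠ 0 ∧ S = compOf A p}

/-- The matrix agreeing with `A` on the positions of `S` and vanishing elsewhere. -/
noncomputable def restrictTo (S : Set (Fin n × Fin n)) (A : Mat n F) : Mat n F :=
  Matrix.of fun i j => if (i, j) ∈ S then A i j else 0

/-- At most one connected component of `G_A` has more than one vertex. -/
def AtMostOneBig (A : Mat n F) : Prop :=
  ∀ p q : Fin n × Fin n, A p.1 p.2 ≠ 0 → A q.1 q.2 ≠ 0 →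
    1 < (compOf A p).ncard → 1 < (compOf A q).ncard → compOf A p = compOf A q

end Defs

section Averaging

variable {α X κ : Type*}

/-- Double counting of a sum over an orbit `O` of `x` under a finite set `G` of transformations
which is closed under a multiplication `m` with injective right translations. -/
theorem card_orbit_mul_sum_eq [DecidableEq X] (G : Finset α) (O : Finset X) (act : α → X → X) (m : α → α → α)
    (x : X) (hO : O = G.image (fun g => act g x))
    (hm : ∀ g ∈ G, ∀ h ∈ G, m g h ∈ G)
    (hact : ∀ g ∈ G, ∀ h ∈ G, act g (act h x) = act (m g h) x)
    (hinj : ∀ h ∈ G, Set.InjOn (fun g => m g h) G)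
    (hactinj : ∀ g ∈ G, Set.InjOn (act g) O) (φ : X → ℂ) :
    (O.card : ℂ) * ∑ g ∈ G, φ (act g x) = (G.card : ℂ) * ∑ y ∈ O, φ y := by
  have translate : ∀ y ∈ O, ∑ g ∈ G, φ (act g y) = ∑ g ∈ G, φ (act g x) := by
    intro y hy
    rw [hO, Finset.mem_image] at hy
    obtain ⟨h, hh, rfl⟩ := hy
    have himage : G.image (fun g => m g h) = G :=
      Finset.eq_of_subset_of_card_le (by
        intro z hz
        obtain ⟨g, hg, rfl⟩ := Finset.mem_image.1 hz
        exact hm g hg h hh) (Finset.card_image_of_injOn (hinj h hh)).ge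
    conv_rhs => rw [← himage]
    rw [Finset.sum_image (hinj h hh)]
    exact Finset.sum_congr rfl fun g hg => by rw [hact g hg h hh]
  have permute : ∀ g ∈ G, ∑ y ∈ O, φ (act g y) = ∑ y ∈ O, φ y := by
    intro g hg
    have himage : O.image (act g) = O :=
      Finset.eq_of_subset_of_card_le (by
        intro z hz
        obtain ⟨y, hy, rfl⟩ := Finset.mem_image.1 hz
        rw [hO, Finset.mem_image] at hy ⊢
        obtain ⟨h, hh, rfl⟩ := hy
        exact ⟨m g h, hm g hg h hh, (hact g hg h hh).symm⟩)
        (Finset.card_image_of_injOn (hactinj g hg)).ge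
    conv_rhs => rw [← himage]
    rw [Finset.sum_image (hactinj g hg)]
  calc (O.card : ℂ) * ∑ g ∈ G, φ (act g x) = ∑ y ∈ O, ∑ g ∈ G, φ (act g y) := by
        rw [Finset.sum_congr rfl translate, Finset.sum_const, nsmul_eq_mul]
    _ = ∑ g ∈ G, ∑ y ∈ O, φ (act g y) := Finset.sum_comm
    _ = (G.card : ℂ) * ∑ y ∈ O, φ y := by
        rw [Finset.sum_congr rfl permute, Finset.sum_const, nsmul_eq_mul]

/-- The average of `f` over the finite set `Ω`. -/
noncomputable def finAvg (Ω : Finset α) (f : α → ℂ) : ℂ := (∑ ω ∈ Ω, f ω) / Ω.card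

theorem finAvg_congr {Ω : Finset α} {f g : α → ℂ} (h : ∀ ω ∈ Ω, f ω = g ω) :
    finAvg Ω f = finAvg Ω g := by
  rw [finAvg, finAvg, Finset.sum_congr rfl h]

theorem finAvg_one {Ω : Finset α} (hΩ : Ω.Nonempty) : finAvg Ω (fun _ => 1) = 1 := by
  have : (Ω.card : ℂ) ≠ 0 := by exact_mod_cast hΩ.card_ne_zero
  simp [finAvg, this]

/-- Independence of `f` and `g`, where `mix x y` combines the coordinates of `x` on which `f`
depends with the remaining coordinates of `y`. -/
theorem finAvg_mul {Ω : Finset α} (hΩ : Ω.Nonempty) (mix : α → α → α)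
    (hmix : ∀ x ∈ Ω, ∀ y ∈ Ω, mix x y ∈ Ω)
    (hinv : ∀ x y, mix (mix x y) (mix y x) = x) (f g : α → ℂ)
    (hf : ∀ x y, f (mix x y) = f x) (hg : ∀ x y, g (mix x y) = g y) :
    finAvg Ω (fun ω => f ω * g ω) = finAvg Ω f * finAvg Ω g := by
  have key : (∑ x ∈ Ω, f x) * ∑ y ∈ Ω, g y = Ω.card * ∑ x ∈ Ω, f x * g x := by
    calc (∑ x ∈ Ω, f x) * ∑ y ∈ Ω, g y = ∑ p ∈ Ω ×ˢ Ω, f p.1 * g p.2 := by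
          rw [Finset.sum_mul_sum, Finset.sum_product]
      _ = ∑ p ∈ Ω ×ˢ Ω, f p.1 * g p.1 := by
          refine Finset.sum_bij' (fun p _ => (mix p.1 p.2, mix p.2 p.1))
            (fun p _ => (mix p.1 p.2, mix p.2 p.1)) ?_ ?_ ?_ ?_ ?_
          · intro p hp
            rw [Finset.mem_product] at hp ⊢
            exact ⟨hmix _ hp.1 _ hp.2, hmix _ hp.2 _ hp.1⟩
          · intro p hp
            rw [Finset.mem_product] at hp ⊢
            exact ⟨hmix _ hp.1 _ hp.2, hmix _ hp.2 _ hp.1⟩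
          · intro p _
            simp [hinv]
          · intro p _
            simp [hinv]
          · intro p _
            simp [hf, hg]
      _ = Ω.card * ∑ x ∈ Ω, f x * g x := by
          rw [Finset.sum_product]
          simp [Finset.mul_sum]
  have hc : (Ω.card : ℂ) ≠ 0 := by exact_mod_cast hΩ.card_ne_zero
  rw [finAvg, finAvg, finAvg, div_mul_div_comm, key]
  field_simp

theorem finAvg_prod {Ω : Finset α} (hΩ : Ω.Nonempty) (s : Finset κ) (mix : κ → α → α → α)
    (hmix : ∀ t ∈ s, ∀ x ∈ Ω, ∀ y ∈ Ω, mix t x y ∈ Ω)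
    (hinv : ∀ t ∈ s, ∀ x y, mix t (mix t x y) (mix t y x) = x) (f : κ → α → ℂ)
    (hf : ∀ t ∈ s, ∀ x y, f t (mix t x y) = f t x)
    (hg : ∀ t ∈ s, ∀ t' ∈ s, t' ≠ t → ∀ x y, f t' (mix t x y) = f t' y) :
    finAvg Ω (fun ω => ∏ t ∈ s, f t ω) = ∏ t ∈ s, finAvg Ω (f t) := by
  induction s using Finset.induction_on with
  | empty => simpa using finAvg_one hΩ
  | insert t s hts ih =>
    have hsub : ∀ r ∈ s, r ∈ insert t s := fun r hr => Finset.mem_insert_of_mem hr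
    have ht := Finset.mem_insert_self t s
    rw [Finset.prod_insert hts, ← ih (fun r hr => hmix r (hsub r hr))
      (fun r hr => hinv r (hsub r hr)) (fun r hr => hf r (hsub r hr))
      (fun r hr r' hr' => hg r (hsub r hr) r' (hsub r' hr')),
      ← finAvg_mul hΩ (mix t) (hmix t ht) (hinv t ht) _ _ (hf t ht)]
    · exact finAvg_congr fun ω _ => Finset.prod_insert hts
    · intro x y
      refine Finset.prod_congr rfl fun r hr => hg t ht r (hsub r hr) ?_ x y
      rintro rfl
      exact hts hr

end Averaging

section PatternGroup

variable {n : ℕ} {F : Type*} [Field F] {P : Fin n → Fin n → Prop}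

theorem patGroup_one : (1 : Mat n F) ∈ patGroup P :=
  ⟨fun i => by simp, fun i j hij _ => by simp [hij]⟩

theorem patGroup_mul (hP1 : ∀ i j : Fin n, P i j → i < j)
    (hP2 : ∀ i j k : Fin n, P i j → P j k → P i k) {a b : Mat n F}
    (ha : a ∈ patGroup P) (hb : b ∈ patGroup P) : a * b ∈ patGroup P := by
  constructor
  · intro i
    rw [Matrix.mul_apply, Finset.sum_eq_single i]
    · rw [ha.1, hb.1, one_mul]
    · intro k _ hk
      by_cases h1 : P i k
      · have h2 : ¬ P k i := fun h => (lt_asymm (hP1 _ _ h) (hP1 _ _ h1))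
        rw [hb.2 k i hk h2, mul_zero]
      · rw [ha.2 i k (Ne.symm hk) h1, zero_mul]
    · simp
  · intro i j hij hPij
    rw [Matrix.mul_apply]
    refine Finset.sum_eq_zero fun k _ => ?_
    by_cases hik : i = k
    · subst hik
      rw [hb.2 i j hij hPij, mul_zero]
    by_cases hkj : k = j
    · subst hkj
      rw [ha.2 i k hij hPij, zero_mul]
    by_cases h1 : P i k
    · rw [hb.2 k j hkj (fun h => hPij (hP2 _ _ _ h1 h)), mul_zero]
    · rw [ha.2 i k hik h1, zero_mul]

theorem isUnit_of_mem_patGroup (hP1 : ∀ i j : Fin n, P i j → i < j) {a : Mat n F}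
    (ha : a ∈ patGroup P) : IsUnit a.det := by
  rw [Matrix.det_of_isUpperTriangular]
  · simp [ha.1]
  · intro i j hij
    exact ha.2 i j (ne_of_gt hij) fun h => lt_asymm (hP1 _ _ h) hij

/-- The right action of a pair of matrices on functionals, `λ ↦ (x ↦ λ (a x b))`. -/
noncomputable def dualAct (P : Fin n → Fin n → Prop) (g : Mat n F × Mat n F) (lam : Mat n F) :
    Mat n F :=
  truncP P (g.1ᵀ * lam * g.2ᵀ)

theorem truncP_of_support {lam : Mat n F} (h : ∀ i j, ¬ P i j → lam i j = 0) :
    truncP P lam = lam := by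
  ext i j
  by_cases hij : P i j <;> simp [truncP, hij, h]

theorem truncP_mul_truncP_mul (hP2 : ∀ i j k : Fin n, P i j → P j k → P i k) {a b : Mat n F}
    (ha : a ∈ patGroup P) (hb : b ∈ patGroup P) (M : Mat n F) :
    truncP P (aᵀ * truncP P M * bᵀ) = truncP P (aᵀ * M * bᵀ) := by
  ext k l
  by_cases hkl : P k l
  · simp only [truncP, Matrix.of_apply, hkl, if_true, Matrix.mul_apply, Matrix.transpose_apply,
      Finset.sum_mul]
    refine Finset.sum_congr rfl fun j _ => Finset.sum_congr rfl fun i _ => ?_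
    by_cases hij : P i j
    · simp [hij]
    · rw [if_neg hij]
      by_cases hik : i = k
      · subst hik
        have hlj : l ≠ j := by
          rintro rfl
          exact hij hkl
        rw [hb.2 l j hlj fun h => hij (hP2 _ _ _ hkl h)]
        simp
      by_cases hPik : P i k
      · have hlj : l ≠ j := by
          rintro rfl
          exact hij (hP2 _ _ _ hPik hkl)
        rw [hb.2 l j hlj fun h => hij (hP2 _ _ _ hPik (hP2 _ _ _ hkl h))]
        simp
      · rw [ha.2 i k hik hPik]
        simp
  · simp [truncP, hkl]

theorem dualAct_dualAct (hP2 : ∀ i j k : Fin n, P i j → P j k → P i k)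
    {g h : Mat n F × Mat n F} (hg1 : g.1 ∈ patGroup P) (hg2 : g.2 ∈ patGroup P)
    (lam : Mat n F) :
    dualAct P g (dualAct P h lam) = dualAct P (h.1 * g.1, g.2 * h.2) lam := by
  rw [dualAct, dualAct, truncP_mul_truncP_mul hP2 hg1 hg2, dualAct]
  simp only [Matrix.transpose_mul, Matrix.mul_assoc]

theorem pairM_truncP (M : Mat n F) {x : Mat n F} (hx : ∀ i j, ¬ P i j → x i j = 0) :
    pairM (truncP P M) x = pairM M x := by
  unfold pairM
  refine Finset.sum_congr rfl fun i _ => Finset.sum_congr rfl fun j _ => ?_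
  by_cases hij : P i j <;> simp [truncP, hij, hx]

theorem pairM_eq_trace (A B : Mat n F) : pairM A B = (Aᵀ * B).trace := by
  simp only [pairM, Matrix.trace, Matrix.diag_apply, Matrix.mul_apply, Matrix.transpose_apply]
  exact Finset.sum_comm

theorem pairM_transpose_mul_mul_transpose (lam a b x : Mat n F) :
    pairM (aᵀ * lam * bᵀ) x = pairM lam (a * x * b) := by
  rw [pairM_eq_trace, pairM_eq_trace]
  simp only [Matrix.transpose_mul, Matrix.transpose_transpose, Matrix.mul_assoc]
  rw [Matrix.trace_mul_comm b]
  simp only [Matrix.mul_assoc]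

variable [Fintype F]

theorem patGroup_inv (hP1 : ∀ i j : Fin n, P i j → i < j)
    (hP2 : ∀ i j k : Fin n, P i j → P j k → P i k) {a : Mat n F}
    (ha : a ∈ patGroup P) : a⁻¹ ∈ patGroup P := by
  have hunit := isUnit_of_mem_patGroup hP1 ha
  have hinj : Set.InjOn (fun b => a * b) (patGroup P : Set (Mat n F)) := by
    intro b _ c _ hbc
    have := congrArg (fun z => a⁻¹ * z) hbc
    simpa [Matrix.nonsing_inv_mul_cancel_left _ _ hunit] using this
  obtain ⟨b, hb, hab⟩ := Set.surj_on_of_inj_on_of_ncard_le (s := patGroup P) (t := patGroup P)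
    (fun b (_ : b ∈ patGroup P) => a * b) (fun b hb => patGroup_mul hP1 hP2 ha hb)
    (fun b c hb hc h => hinj hb hc h) le_rfl (Set.toFinite _) 1 patGroup_one
  rwa [Matrix.inv_eq_right_inv hab.symm]

/-- The pattern group as a finite set. -/
noncomputable def patFin (P : Fin n → Fin n → Prop) : Finset (Mat n F) :=
  (Set.toFinite (patGroup P)).toFinset

theorem mem_patFin {a : Mat n F} : a ∈ patFin P ↔ a ∈ patGroup P := by
  simp [patFin]

theorem dualAct_injOn (hP1 : ∀ i j : Fin n, P i j → i < j)
    (hP2 : ∀ i j k : Fin n, P i j → P j k → P i k) {g : Mat n F × Mat n F}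
    (hg1 : g.1 ∈ patGroup P) (hg2 : g.2 ∈ patGroup P) :
    Set.InjOn (dualAct P g) {lam | ∀ i j, ¬ P i j → lam i j = 0} := by
  have hleft : ∀ lam : Mat n F, (∀ i j, ¬ P i j → lam i j = 0) →
      dualAct P (g.1⁻¹, g.2⁻¹) (dualAct P g lam) = lam := by
    intro lam hlam
    rw [dualAct_dualAct hP2 (patGroup_inv hP1 hP2 hg1) (patGroup_inv hP1 hP2 hg2)]
    simp only [Matrix.mul_nonsing_inv _ (isUnit_of_mem_patGroup hP1 hg1),
      Matrix.nonsing_inv_mul _ (isUnit_of_mem_patGroup hP1 hg2)]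
    simp [dualAct, truncP_of_support hlam]
  intro x hx y hy hxy
  rw [← hleft x hx, hxy, hleft y hy]

/-- Orbit sums of `dualAct` as sums over pairs of matrices. -/
theorem card_dualAct_orbit_mul_sum (hP1 : ∀ i j : Fin n, P i j → i < j)
    (hP2 : ∀ i j k : Fin n, P i j → P j k → P i k) (V : Finset (Mat n F))
    (hV : ∀ b ∈ V, b ∈ patGroup P) (hVmul : ∀ b ∈ V, ∀ c ∈ V, b * c ∈ V)
    (lam : Mat n F) (φ : Mat n F → ℂ) :
    (((patFin (F := F) P ×ˢ V).image (fun g => dualAct P g lam)).card : ℂ) *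
        ∑ g ∈ patFin (F := F) P ×ˢ V, φ (dualAct P g lam) =
      ((patFin (F := F) P ×ˢ V).card : ℂ) *
        ∑ y ∈ (patFin (F := F) P ×ˢ V).image (fun g => dualAct P g lam), φ y := by
  refine card_orbit_mul_sum_eq _ _ (dualAct P) (fun g h => (h.1 * g.1, g.2 * h.2)) lam rfl
    ?_ ?_ ?_ ?_ φ
  · intro g hg h hh
    rw [Finset.mem_product, mem_patFin] at *
    exact ⟨patGroup_mul hP1 hP2 hh.1 hg.1, hVmul _ hg.2 _ hh.2⟩
  · intro g hg h _
    rw [Finset.mem_product, mem_patFin] at hg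
    exact dualAct_dualAct hP2 hg.1 (hV _ hg.2) lam
  · intro h hh g _ g' _ heq
    rw [Finset.mem_product, mem_patFin] at hh
    have h1 := isUnit_of_mem_patGroup hP1 hh.1
    have h2 := isUnit_of_mem_patGroup hP1 (hV _ hh.2)
    simp only [Prod.mk.injEq] at heq
    refine Prod.ext ?_ ?_
    · rw [← Matrix.nonsing_inv_mul_cancel_left h.1 g.1 h1, heq.1,
        Matrix.nonsing_inv_mul_cancel_left _ _ h1]
    · rw [← Matrix.mul_nonsing_inv_cancel_right h.2 g.2 h2, heq.2,
        Matrix.mul_nonsing_inv_cancel_right _ _ h2]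
  · intro g hg
    rw [Finset.mem_product, mem_patFin] at hg
    refine (dualAct_injOn hP1 hP2 hg.1 (hV _ hg.2)).mono ?_
    intro y hy
    obtain ⟨h, _, rfl⟩ := Finset.mem_image.1 (Finset.mem_coe.1 hy)
    intro i j hij
    simp [dualAct, truncP, hij]

theorem exists_patGroup_inv_iff (hP1 : ∀ i j : Fin n, P i j → i < j)
    (hP2 : ∀ i j k : Fin n, P i j → P j k → P i k) (p : Mat n F → Prop) :
    (∃ a ∈ (patGroup P : Set (Mat n F)), p a⁻¹) ↔ ∃ a ∈ (patGroup P : Set (Mat n F)), p a := by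
  constructor
  · rintro ⟨a, ha, h⟩
    exact ⟨a⁻¹, patGroup_inv hP1 hP2 ha, h⟩
  · rintro ⟨a, ha, h⟩
    refine ⟨a⁻¹, patGroup_inv hP1 hP2 ha, ?_⟩
    rwa [Matrix.nonsing_inv_nonsing_inv _ (isUnit_of_mem_patGroup hP1 ha)]

theorem dualOrbit_eq_image (hP1 : ∀ i j : Fin n, P i j → i < j)
    (hP2 : ∀ i j k : Fin n, P i j → P j k → P i k) (lam : Mat n F) :
    dualOrbit P lam =
      ((patFin P ×ˢ patFin P).image (fun g => dualAct P g lam) : Finset (Mat n F)) := by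
  ext mu
  simp only [dualOrbit, Set.mem_ofPred_eq, Finset.coe_image, Set.mem_image, Finset.mem_coe,
    Finset.mem_product, mem_patFin, Prod.exists, dualAct]
  rw [exists_patGroup_inv_iff hP1 hP2
    (fun a => ∃ b ∈ patGroup P, mu = truncP P (aᵀ * lam * (b⁻¹)ᵀ))]
  constructor
  · rintro ⟨a, ha, h⟩
    rw [exists_patGroup_inv_iff hP1 hP2 (fun b => mu = truncP P (aᵀ * lam * bᵀ))] at h
    obtain ⟨b, hb, rfl⟩ := h
    exact ⟨a, b, ⟨ha, hb⟩, rfl⟩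
  · rintro ⟨a, b, ⟨ha, hb⟩, rfl⟩
    refine ⟨a, ha, ?_⟩
    rw [exists_patGroup_inv_iff hP1 hP2
      (fun c => truncP P (aᵀ * lam * bᵀ) = truncP P (aᵀ * lam * cᵀ))]
    exact ⟨b, hb, rfl⟩

theorem dualLeftOrbit_eq_image (hP1 : ∀ i j : Fin n, P i j → i < j)
    (hP2 : ∀ i j k : Fin n, P i j → P j k → P i k) (lam : Mat n F) :
    dualLeftOrbit P lam =
      ((patFin P ×ˢ {1}).image (fun g => dualAct P g lam) : Finset (Mat n F)) := by
  ext mu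
  simp only [dualLeftOrbit, Set.mem_ofPred_eq, Finset.coe_image, Set.mem_image, Finset.mem_coe,
    Finset.mem_product, mem_patFin, Prod.exists, dualAct, Finset.mem_singleton]
  rw [exists_patGroup_inv_iff hP1 hP2 (fun a => mu = truncP P (aᵀ * lam))]
  constructor
  · rintro ⟨a, ha, rfl⟩
    exact ⟨a, 1, ⟨ha, rfl⟩, by simp⟩
  · rintro ⟨a, b, ⟨ha, rfl⟩, rfl⟩
    exact ⟨a, ha, by simp⟩

theorem patFin_nonempty : (patFin P : Finset (Mat n F)).Nonempty :=
  ⟨1, mem_patFin.2 patGroup_one⟩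

/-- The size of a left orbit is the inverse of the proportion of the stabilizer. -/
theorem ncard_dualLeftOrbit_mul_finAvg (hP1 : ∀ i j : Fin n, P i j → i < j)
    (hP2 : ∀ i j k : Fin n, P i j → P j k → P i k) {lam : Mat n F}
    (hlam : ∀ i j, ¬ P i j → lam i j = 0) :
    ((dualLeftOrbit P lam).ncard : ℂ) *
      finAvg (patFin P) (fun a => if truncP P (aᵀ * lam) = lam then 1 else 0) = 1 := by
  have hsum := card_dualAct_orbit_mul_sum hP1 hP2 {1}
    (fun b hb => by rw [Finset.mem_singleton.1 hb]; exact patGroup_one)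
    (fun b hb c hc => by
      rw [Finset.mem_singleton.1 hb, Finset.mem_singleton.1 hc]; simp) lam
    (fun mu => if mu = lam then 1 else 0)
  have hmem : lam ∈ (patFin P ×ˢ {1}).image (fun g => dualAct P g lam) :=
    Finset.mem_image.2 ⟨(1, 1), by simp [mem_patFin, patGroup_one],
      by simp [dualAct, truncP_of_support hlam]⟩
  have hc : ((patFin P : Finset (Mat n F)).card : ℂ) ≠ 0 := by
    exact_mod_cast patFin_nonempty.card_ne_zero
  rw [Finset.sum_ite_eq' _ lam, if_pos hmem] at hsum
  rw [dualLeftOrbit_eq_image hP1 hP2, Set.ncard_coe_finset, finAvg, mul_div_assoc',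
    div_eq_one_iff_eq hc]
  simpa [Finset.sum_product, dualAct, Finset.card_product] using hsum

/-- The supercharacter as an average over `U_P × U_P`. -/
theorem superChar_eq_mul_finAvg (hP1 : ∀ i j : Fin n, P i j → i < j)
    (hP2 : ∀ i j k : Fin n, P i j → P j k → P i k) (θ : AddChar F ℂ) (lam : Mat n F)
    {u : Mat n F} (hu : ∀ i j, ¬ P i j → (u - 1) i j = 0) :
    superChar P θ lam u = ((dualLeftOrbit P lam).ncard : ℂ) *
      finAvg (patFin P ×ˢ patFin P) (fun g => θ (-pairM lam (g.1 * (u - 1) * g.2))) := by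
  have hsum := card_dualAct_orbit_mul_sum hP1 hP2 (patFin P) (fun b hb => mem_patFin.1 hb)
    (fun b hb c hc => mem_patFin.2
      (patGroup_mul hP1 hP2 (mem_patFin.1 hb) (mem_patFin.1 hc))) lam
    (fun mu => θ (-pairM mu (u - 1)))
  have hne : (patFin P ×ˢ patFin P : Finset (Mat n F × Mat n F)).Nonempty :=
    patFin_nonempty.product patFin_nonempty
  have hc : ((patFin P ×ˢ patFin P : Finset (Mat n F × Mat n F)).card : ℂ) ≠ 0 := by
    exact_mod_cast hne.card_ne_zero
  have ho : (((patFin P ×ˢ patFin P).image (fun g => dualAct P g lam)).card : ℂ) ≠ 0 := by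
    exact_mod_cast (hne.image _).card_ne_zero
  rw [superChar, dualOrbit_eq_image hP1 hP2, Set.ncard_coe_finset, finsum_mem_coe_finset,
    div_mul_eq_mul_div, mul_div_assoc]
  congr 1
  rw [finAvg, div_eq_div_iff ho hc, mul_comm, ← hsum, mul_comm]
  congr 1
  refine Finset.sum_congr rfl fun g _ => ?_
  rw [dualAct, pairM_truncP _ hu, pairM_transpose_mul_mul_transpose]

theorem superChar_one (hP1 : ∀ i j : Fin n, P i j → i < j)
    (hP2 : ∀ i j k : Fin n, P i j → P j k → P i k) (θ : AddChar F ℂ) (lam : Mat n F) :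
    superChar P θ lam 1 = ((dualLeftOrbit P lam).ncard : ℂ) := by
  rw [superChar_eq_mul_finAvg hP1 hP2 θ lam (by simp)]
  have h : ∀ g : Mat n F × Mat n F, θ (-pairM lam (g.1 * (1 - 1) * g.2)) = 1 := by
    intro g
    simp [pairM]
  simp only [h, finAvg_one (patFin_nonempty.product patFin_nonempty), mul_one]

end PatternGroup

section Components

variable {n : ℕ} {F : Type*} [Field F] {A : Mat n F}

theorem adjRel_symm {p q : Fin n × Fin n} (h : adjRel A p q) : adjRel A q p :=
  ⟨h.1.symm, h.2.2.1, h.2.1, h.2.2.2.imp Eq.symm Eq.symm⟩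

theorem reflTransGen_adjRel_symm {p q : Fin n × Fin n}
    (h : Relation.ReflTransGen (adjRel A) p q) : Relation.ReflTransGen (adjRel A) q p :=
  have : Std.Symm (adjRel A) := ⟨fun _ _ => adjRel_symm⟩
  Std.Symm.symm _ _ h

theorem compOf_eq_of_mem {p q : Fin n × Fin n} (h : q ∈ compOf A p) :
    compOf A p = compOf A q := by
  ext r
  exact ⟨fun hr => (reflTransGen_adjRel_symm h).trans hr,
    fun hr => Relation.ReflTransGen.trans h hr⟩

theorem eq_compOf_of_mem {T : Set (Fin n × Fin n)} (hT : T ∈ comps A) {q : Fin n × Fin n}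
    (hq : q ∈ T) : T = compOf A q := by
  obtain ⟨p, _, rfl⟩ := hT
  exact compOf_eq_of_mem hq

theorem restrictTo_ne_zero {T : Set (Fin n × Fin n)} {i j : Fin n}
    (h : restrictTo T A i j ≠ 0) : (i, j) ∈ T ∧ A i j ≠ 0 := by
  by_cases hT : (i, j) ∈ T
  · exact ⟨hT, by simpa [restrictTo, hT] using h⟩
  · simp [restrictTo, hT] at h

theorem comps_eq_of_restrictTo_ne_zero {T T' : Set (Fin n × Fin n)} (hT : T ∈ comps A)
    (hT' : T' ∈ comps A) {i j i' j' : Fin n} (h : restrictTo T A i j ≠ 0)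
    (h' : restrictTo T' A i' j' ≠ 0) (hij : i = i' ∨ j = j') : T = T' := by
  obtain ⟨h1, h2⟩ := restrictTo_ne_zero h
  obtain ⟨h1', h2'⟩ := restrictTo_ne_zero h'
  rw [eq_compOf_of_mem hT h1, eq_compOf_of_mem hT' h1']
  by_cases heq : (i, j) = (i', j')
  · rw [heq]
  · exact compOf_eq_of_mem (Relation.ReflTransGen.single ⟨heq, h2, h2', hij⟩)

/-- The components of the graph of `A`, as a finite set. -/
noncomputable def compsFin (A : Mat n F) : Finset (Set (Fin n × Fin n)) :=
  (Set.toFinite (comps A)).toFinset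

theorem mem_compsFin {T : Set (Fin n × Fin n)} : T ∈ compsFin A ↔ T ∈ comps A := by
  simp [compsFin]

theorem finprod_comps (f : Set (Fin n × Fin n) → ℂ) :
    ∏ᶠ T ∈ comps A, f T = ∏ T ∈ compsFin A, f T :=
  finprod_mem_eq_finite_toFinset_prod _ _

theorem sum_restrictTo_comps (A : Mat n F) : ∑ T ∈ compsFin A, restrictTo T A = A := by
  ext i j
  rw [Matrix.sum_apply]
  by_cases hA : A i j = 0
  · rw [hA]
    exact Finset.sum_eq_zero fun T _ => by simp [restrictTo, hA]
  · rw [Finset.sum_eq_single (compOf A (i, j))]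
    · have : (i, j) ∈ compOf A (i, j) := Relation.ReflTransGen.refl
      simp [restrictTo, this]
    · intro T hT hne
      by_contra h
      exact hne (eq_compOf_of_mem (mem_compsFin.1 hT) (restrictTo_ne_zero h).1)
    · intro h
      exact absurd (mem_compsFin.2 ⟨(i, j), hA, rfl⟩) h

theorem restrictTo_eq_zero {T : Set (Fin n × Fin n)} {i j : Fin n} (h : A i j = 0) :
    restrictTo T A i j = 0 := by
  simp [restrictTo, h]

end Components

section Factorization

variable {n : ℕ} {F : Type*}

/-- The matrix with the entries of `a` on `D` and those of `b` off `D`. -/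
noncomputable def mixOn (D : Set (Fin n × Fin n)) (a b : Mat n F) : Mat n F :=
  Matrix.of fun i j => if (i, j) ∈ D then a i j else b i j

theorem mixOn_mixOn (D : Set (Fin n × Fin n)) (a b : Mat n F) :
    mixOn D (mixOn D a b) (mixOn D b a) = a := by
  ext i j
  by_cases h : (i, j) ∈ D <;> simp [mixOn, h]

theorem mixOn_apply_of_mem {D : Set (Fin n × Fin n)} {i j : Fin n} (h : (i, j) ∈ D)
    (a b : Mat n F) : mixOn D a b i j = a i j := by
  simp [mixOn, h]

theorem mixOn_apply_of_notMem {D : Set (Fin n × Fin n)} {i j : Fin n} (h : (i, j) ∉ D)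
    (a b : Mat n F) : mixOn D a b i j = b i j := by
  simp [mixOn, h]

variable [Field F]

theorem mixOn_mem_patGroup {P : Fin n → Fin n → Prop} (D : Set (Fin n × Fin n)) {a b : Mat n F}
    (ha : a ∈ patGroup P) (hb : b ∈ patGroup P) : mixOn D a b ∈ patGroup P := by
  refine ⟨fun i => ?_, fun i j hij hP => ?_⟩
  · simp [mixOn, ha.1, hb.1]
  · simp [mixOn, ha.2 i j hij hP, hb.2 i j hij hP]

theorem pairM_congr {lam x a a' b b' : Mat n F}
    (ha : ∀ i j k l, lam i j ≠ 0 → x k l ≠ 0 → a i k = a' i k)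
    (hb : ∀ i j k l, lam i j ≠ 0 → x k l ≠ 0 → b l j = b' l j) :
    pairM lam (a * x * b) = pairM lam (a' * x * b') := by
  simp only [pairM, Matrix.mul_apply, Finset.mul_sum, Finset.sum_mul]
  refine Finset.sum_congr rfl fun i _ => Finset.sum_congr rfl fun j _ =>
    Finset.sum_congr rfl fun l _ => Finset.sum_congr rfl fun k _ => ?_
  by_cases h1 : lam i j = 0
  · simp [h1]
  by_cases h2 : x k l = 0
  · simp [h2]
  rw [ha i j k l h1 h2, hb i j k l h1 h2]

theorem transpose_mul_congr {lam a a' : Mat n F}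
    (ha : ∀ i j k, lam i j ≠ 0 → a i k = a' i k) : aᵀ * lam = a'ᵀ * lam := by
  ext k j
  simp only [Matrix.mul_apply, Matrix.transpose_apply]
  refine Finset.sum_congr rfl fun i _ => ?_
  by_cases h : lam i j = 0
  · simp [h]
  · rw [ha i j k h]

theorem pairM_sum_sum {κ κ' : Type*} (s : Finset κ) (t : Finset κ') (f : κ → Mat n F)
    (g : κ' → Mat n F) (a b : Mat n F) :
    pairM (∑ i ∈ s, f i) (a * (∑ j ∈ t, g j) * b) =
      ∑ p ∈ s ×ˢ t, pairM (f p.1) (a * g p.2 * b) := by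
  simp only [pairM_eq_trace, Matrix.transpose_sum, Finset.mul_sum, Finset.sum_mul,
    Matrix.trace_sum, Finset.sum_product]
  exact Finset.sum_comm

theorem addChar_neg_sum {κ : Type*} (θ : AddChar F ℂ) (s : Finset κ) (f : κ → F) :
    θ (-∑ i ∈ s, f i) = ∏ i ∈ s, θ (-f i) := by
  induction s using Finset.induction_on with
  | empty => simp
  | insert i s hi ih =>
    rw [Finset.sum_insert hi, Finset.prod_insert hi, neg_add, AddChar.map_add_eq_mul, ih]

theorem transpose_mul_restrictTo_apply {lam : Mat n F} {T : Set (Fin n × Fin n)}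
    (hT : T ∈ comps lam) (a : Mat n F) {i j : Fin n} (k : Fin n)
    (hij : restrictTo T lam i j ≠ 0) :
    (aᵀ * restrictTo T lam) k j = (aᵀ * lam) k j ∧ restrictTo T lam k j = lam k j := by
  have key : ∀ i', restrictTo T lam i' j = lam i' j := by
    intro i'
    by_cases h : lam i' j = 0
    · simp [restrictTo, h]
    · have hself : (i', j) ∈ compOf lam (i', j) := Relation.ReflTransGen.refl
      have hTeq : T = compOf lam (i', j) :=
        comps_eq_of_restrictTo_ne_zero hT ⟨(i', j), h, rfl⟩ hij
          (i' := i') (j' := j) (by simpa [restrictTo, hself] using h) (Or.inr rfl)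
      simp [restrictTo, hTeq, hself]
  exact ⟨by simp [Matrix.mul_apply, key], key k⟩

theorem truncP_transpose_mul_eq_iff {P : Fin n → Fin n → Prop} {lam : Mat n F} (a : Mat n F) :
    truncP P (aᵀ * lam) = lam ↔
      ∀ T ∈ compsFin lam, truncP P (aᵀ * restrictTo T lam) = restrictTo T lam := by
  constructor
  · intro h T hT
    ext k j
    by_cases hj : ∃ i, restrictTo T lam i j ≠ 0
    · obtain ⟨i, hij⟩ := hj
      obtain ⟨h1, h2⟩ := transpose_mul_restrictTo_apply (mem_compsFin.1 hT) a k hij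
      rw [h2, ← congrFun (congrFun h k) j]
      simp [truncP, h1]
    · push Not at hj
      rw [hj k]
      simp [truncP, Matrix.mul_apply, hj]
  · intro h
    have hsum : truncP P (aᵀ * ∑ T ∈ compsFin lam, restrictTo T lam) =
        ∑ T ∈ compsFin lam, truncP P (aᵀ * restrictTo T lam) := by
      ext k j
      by_cases hP : P k j <;> simp [truncP, Matrix.sum_apply, Finset.mul_sum, hP]
    rw [sum_restrictTo_comps, Finset.sum_congr rfl h, sum_restrictTo_comps] at hsum
    exact hsum

variable [Fintype F] {P : Fin n → Fin n → Prop}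

theorem finAvg_pairM_eq_prod (θ : AddChar F ℂ) (lam x : Mat n F) :
    finAvg (patFin P ×ˢ patFin P) (fun g => θ (-pairM lam (g.1 * x * g.2))) =
      ∏ p ∈ compsFin lam ×ˢ compsFin x, finAvg (patFin P ×ˢ patFin P)
        (fun g => θ (-pairM (restrictTo p.1 lam) (g.1 * restrictTo p.2 x * g.2))) := by
  let D : Set (Fin n × Fin n) × Set (Fin n × Fin n) → Set (Fin n × Fin n) := fun p =>
    {r | ∃ j l, restrictTo p.1 lam r.1 j ≠ 0 ∧ restrictTo p.2 x r.2 l ≠ 0}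
  let D' : Set (Fin n × Fin n) × Set (Fin n × Fin n) → Set (Fin n × Fin n) := fun p =>
    {r | ∃ i k, restrictTo p.1 lam i r.2 ≠ 0 ∧ restrictTo p.2 x k r.1 ≠ 0}
  rw [← finAvg_prod (patFin_nonempty.product patFin_nonempty) _
    (fun p g h => (mixOn (D p) g.1 h.1, mixOn (D' p) g.2 h.2))]
  · refine finAvg_congr fun g _ => ?_
    rw [← addChar_neg_sum, ← pairM_sum_sum _ _ (fun T => restrictTo T lam)
      (fun S => restrictTo S x), sum_restrictTo_comps, sum_restrictTo_comps]
  · intro p _ g hg h hh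
    rw [Finset.mem_product, mem_patFin, mem_patFin] at *
    exact ⟨mixOn_mem_patGroup _ hg.1 hh.1, mixOn_mem_patGroup _ hg.2 hh.2⟩
  · intro p _ g h
    simp [mixOn_mixOn]
  · intro p _ g h
    dsimp only
    rw [pairM_congr (a' := g.1) (b' := g.2)]
    · intro i j k l h1 h2
      exact mixOn_apply_of_mem (D := D p) ⟨j, l, h1, h2⟩ _ _
    · intro i j k l h1 h2
      exact mixOn_apply_of_mem (D := D' p) ⟨i, k, h1, h2⟩ _ _
  · intro p hp p' hp' hne g h
    simp only [Finset.mem_product, mem_compsFin] at hp hp'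
    dsimp only
    rw [pairM_congr (a' := h.1) (b' := h.2)]
    · intro i j k l h1 h2
      refine mixOn_apply_of_notMem ?_ _ _
      rintro ⟨j', l', h1', h2'⟩
      exact hne (Prod.ext
        (comps_eq_of_restrictTo_ne_zero hp'.1 hp.1 h1 h1' (Or.inl rfl))
        (comps_eq_of_restrictTo_ne_zero hp'.2 hp.2 h2 h2' (Or.inl rfl)))
    · intro i j k l h1 h2
      refine mixOn_apply_of_notMem ?_ _ _
      rintro ⟨i', k', h1', h2'⟩
      exact hne (Prod.ext
        (comps_eq_of_restrictTo_ne_zero hp'.1 hp.1 h1 h1' (Or.inr rfl))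
        (comps_eq_of_restrictTo_ne_zero hp'.2 hp.2 h2 h2' (Or.inr rfl)))

theorem finAvg_stabilizer_eq_prod (lam : Mat n F) :
    finAvg (patFin P) (fun a => if truncP P (aᵀ * lam) = lam then 1 else 0) =
      ∏ T ∈ compsFin lam, finAvg (patFin P)
        (fun a => if truncP P (aᵀ * restrictTo T lam) = restrictTo T lam then 1 else 0) := by
  let D : Set (Fin n × Fin n) → Set (Fin n × Fin n) := fun T =>
    {r | ∃ j, restrictTo T lam r.1 j ≠ 0}
  rw [← finAvg_prod patFin_nonempty _ (fun T => mixOn (D T))]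
  · refine finAvg_congr fun a _ => ?_
    by_cases h : truncP P (aᵀ * lam) = lam
    · rw [if_pos h]
      exact (Finset.prod_eq_one fun T hT =>
        if_pos ((truncP_transpose_mul_eq_iff a).1 h T hT)).symm
    · rw [if_neg h]
      rw [truncP_transpose_mul_eq_iff] at h
      push Not at h
      obtain ⟨T, hT, hne⟩ := h
      exact (Finset.prod_eq_zero hT (if_neg hne)).symm
  · intro T _ a ha b hb
    exact mem_patFin.2 (mixOn_mem_patGroup _ (mem_patFin.1 ha) (mem_patFin.1 hb))
  · intro T _ a b
    exact mixOn_mixOn _ a b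
  · intro T _ a b
    rw [transpose_mul_congr (a' := a)]
    intro i j k h
    exact mixOn_apply_of_mem (D := D T) ⟨j, h⟩ _ _
  · intro T hT T' hT' hne a b
    rw [transpose_mul_congr (a' := b)]
    intro i j k h
    refine mixOn_apply_of_notMem ?_ _ _
    rintro ⟨j', h'⟩
    exact hne (comps_eq_of_restrictTo_ne_zero (mem_compsFin.1 hT') (mem_compsFin.1 hT) h h'
      (Or.inl rfl))

theorem ncard_dualLeftOrbit_eq_prod (hP1 : ∀ i j : Fin n, P i j → i < j)
    (hP2 : ∀ i j k : Fin n, P i j → P j k → P i k) {lam : Mat n F}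
    (hlam : ∀ i j, ¬ P i j → lam i j = 0) :
    ((dualLeftOrbit P lam).ncard : ℂ) =
      ∏ T ∈ compsFin lam, ((dualLeftOrbit P (restrictTo T lam)).ncard : ℂ) := by
  have h1 := ncard_dualLeftOrbit_mul_finAvg hP1 hP2 hlam
  have h2 : ∀ T ∈ compsFin lam, ((dualLeftOrbit P (restrictTo T lam)).ncard : ℂ) * finAvg (patFin P)
      (fun a => if truncP P (aᵀ * restrictTo T lam) = restrictTo T lam then 1 else 0) = 1 :=
    fun T _ => ncard_dualLeftOrbit_mul_finAvg hP1 hP2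
      fun i j hij => restrictTo_eq_zero (hlam i j hij)
  rw [eq_inv_of_mul_eq_one_left h1, finAvg_stabilizer_eq_prod, ← Finset.prod_inv_distrib]
  exact Finset.prod_congr rfl fun T hT => (eq_inv_of_mul_eq_one_left (h2 T hT)).symm

end Factorization

/-- With `S_1,…,S_k` the connected components of `G_{u−1}` and `T_1,…,T_l`
those of `G_λ`:
`χ^λ(u) = ∏_j (χ^{λ[T_j]}(1) · ∏_i χ^{λ[T_j]}(u[S_i]) / χ^{λ[T_j]}(1))`. -/
theorem stmt12 {n : ℕ} {F : Type*} [Field F] [Fintype F]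
    (P : Fin n → Fin n → Prop)
    (hP1 : ∀ i j : Fin n, P i j → i < j)
    (hP2 : ∀ i j k : Fin n, P i j → P j k → P i k)
    (θ : AddChar F ℂ) (hθ : ∃ x, θ x ≠ 1)
    (u : Mat n F) (hu : u ∈ patGroup P)
    (lam : Mat n F) (hlam : ∀ i j : Fin n, ¬ P i j → lam i j = 0) :
    superChar P θ lam u =
      ∏ᶠ T ∈ comps lam,
        (superChar P θ (restrictTo T lam) 1 *
          ∏ᶠ S ∈ comps (u - 1),
            (superChar P θ (restrictTo T lam) (1 + restrictTo S (u - 1)) /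
              superChar P θ (restrictTo T lam) 1)) := by
  have hsupp : ∀ i j, ¬ P i j → (u - 1) i j = 0 := by
    intro i j hij
    by_cases h : i = j
    · subst h
      simp [hu.1]
    · simp [hu.2 i j h hij, h]
  rw [superChar_eq_mul_finAvg hP1 hP2 θ lam hsupp, finAvg_pairM_eq_prod,
    ncard_dualLeftOrbit_eq_prod hP1 hP2 hlam, Finset.prod_product, ← Finset.prod_mul_distrib,
    finprod_comps]
  refine Finset.prod_congr rfl fun T _ => ?_
  rw [superChar_one hP1 hP2, finprod_comps]
  congr 1
  refine Finset.prod_congr rfl fun S _ => ?_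
  have hne := left_ne_zero_of_mul_eq_one (ncard_dualLeftOrbit_mul_finAvg hP1 hP2
    (lam := restrictTo T lam) fun i j hij => restrictTo_eq_zero (hlam i j hij))
  rw [superChar_eq_mul_finAvg hP1 hP2, mul_div_cancel_left₀ _ hne, add_sub_cancel_left]
  intro i j hij
  rw [add_sub_cancel_left]
  exact restrictTo_eq_zero (hsupp i j hij)
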